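/- Let (W,S) be a Coxeter system with special subgroups A, B, C such that A ∩ C = {1} = B ∩ C. Then the Gersten–Stallings angle ∠_{⟨A,B⟩}(A, B; A∩B) equals ∠_W(⟨A,C⟩, ⟨B,C⟩; ⟨A∩B, C⟩). In particular, for a ≠ b in S and any T ⊆ S − {a,b}, one has ∠_W(⟨{a} ∪ T⟩, ⟨{b} ∪ T⟩; ⟨T⟩) = π/m_{a,b}. -/

import Mathlib

open CoxeterSystem

namespace CoxFA

variable {B : Type*}

/-- The special subgroup of `W` generated by the simple reflections indexed by `T`. -/
def sp {W : Type*} [Group W] {M : CoxeterMatrix B} (cs : CoxeterSystem M W) (T : Set B) :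
    Subgroup W :=
  Subgroup.closure (cs.simple '' T)

section Amalg

variable {H : Type*} [Group H]

/-- The two-element family of subgroups `A`, `B`. -/
abbrev fam2 (A B : Subgroup H) : Bool → Subgroup H := fun i => cond i A B

/-- The inclusions of `K` into `A` and `B`. -/
def phi2 (A B K : Subgroup H) (hA : K ≤ A) (hB : K ≤ B) :
    (i : Bool) → (↥K →* ↥(fam2 A B i))
  | true => Subgroup.inclusion hA
  | false => Subgroup.inclusion hB

/-- The amalgamated free product `A *_K B`, i.e. the pushout of `A ← K → B`. -/
abbrev AmalgK (A B K : Subgroup H) (hA : K ≤ A) (hB : K ≤ B) : Type _ :=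
  Monoid.PushoutI (phi2 A B K hA hB)

/-- The canonical map `A → A *_K B`. -/
def intoA (A B K : Subgroup H) (hA : K ≤ A) (hB : K ≤ B) :
    ↥A →* AmalgK A B K hA hB :=
  Monoid.PushoutI.of (φ := phi2 A B K hA hB) true

/-- The canonical map `B → A *_K B`. -/
def intoB (A B K : Subgroup H) (hA : K ≤ A) (hB : K ≤ B) :
    ↥B →* AmalgK A B K hA hB :=
  Monoid.PushoutI.of (φ := phi2 A B K hA hB) false

/-- The natural homomorphism `A *_K B → H` induced by the inclusions of `A` and `B` in `H`. -/
noncomputable def rhoK (A B K : Subgroup H) (hA : K ≤ A) (hB : K ≤ B) :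
    AmalgK A B K hA hB →* H :=
  Monoid.PushoutI.lift (fun i => (fam2 A B i).subtype) K.subtype (by
    intro i
    cases i <;> exact MonoidHom.ext fun x => rfl)

end Amalg

section NormalForm

variable {H : Type*} [Group H]

/-- `AltList P Q l` says that the entries of `l` lie alternately in `P` and `Q`,
starting with `P`. -/
def AltList (P Q : Subgroup H) : List H → Prop
  | [] => True
  | x :: l => x ∈ P ∧ AltList Q P l

/-- The set of `k` such that `g` is a product of `k` factors lying alternately in `P` and `Q`. -/
def nfSet (P Q : Subgroup H) (g : H) : Set ℕ :=
  {k | ∃ l : List H, l.length = k ∧ l.prod = g ∧ (AltList P Q l ∨ AltList Q P l)}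

/-- The normal form length of `g`: the minimal number of factors lying alternately in `P` and
`Q` needed to write `g`. -/
noncomputable def nfLength (P Q : Subgroup H) (g : H) : ℕ := sInf (nfSet P Q g)

end NormalForm

open Classical in
/-- The Gersten–Stallings angle between subgroups `E` and `F` of `H` over `K = E ⊓ F`:
`2π/n` where `n` is the minimal normal form length of a nontrivial element of the kernel of
the natural surjection `E *_K F → ⟨E, F⟩ ⊆ H`, or `0` if this map is injective. -/
noncomputable def gsAngle {H : Type*} [Group H] (E F : Subgroup H) : ℝ :=
  if Function.Injective (rhoK E F (E ⊓ F) inf_le_left inf_le_right) then 0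
  else 2 * Real.pi /
    (sInf {k | ∃ g, g ∈ MonoidHom.ker (rhoK E F (E ⊓ F) inf_le_left inf_le_right) ∧ g ≠ 1 ∧
      nfLength (intoA E F (E ⊓ F) inf_le_left inf_le_right).range
        (intoB E F (E ⊓ F) inf_le_left inf_le_right).range g = k} : ℕ)

section GeometricRepresentation

open Polynomial.Chebyshev

/-- The coroot functionals of the geometric representation of a Coxeter group. -/
noncomputable def coroot (M : CoxeterMatrix B) (i : B) : Module.Dual ℝ (B →₀ ℝ) :=
  Finsupp.lift ℝ ℝ B fun j => -2 * Real.cos (Real.pi / M i j)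

theorem coroot_single (M : CoxeterMatrix B) (i j : B) :
    coroot M i (Finsupp.single j 1) = -2 * Real.cos (Real.pi / M i j) := by
  simp [coroot]

theorem coroot_single_self (M : CoxeterMatrix B) (i : B) :
    coroot M i (Finsupp.single i 1) = 2 := by
  simp [coroot_single]

/-- The reflections of the geometric representation of a Coxeter group. -/
noncomputable def geomReflection (M : CoxeterMatrix B) (i : B) : (B →₀ ℝ) ≃ₗ[ℝ] (B →₀ ℝ) :=
  Module.reflection (coroot_single_self M i)

theorem coroot_mul_coroot_sub_two (M : CoxeterMatrix B) (i j : B) :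
    2 * Real.cos (2 * (Real.pi / M i j)) =
      coroot M i (Finsupp.single j 1) * coroot M j (Finsupp.single i 1) - 2 := by
  rw [coroot_single, coroot_single, M.symmetric j i, Real.cos_two_mul]
  ring

theorem chebyshev_S_add_S_eval_two_mul_cos {θ : ℝ} (hθ : Real.sin (2 * θ) ≠ 0) (n : ℤ) :
    ((S ℝ n).eval (2 * Real.cos (2 * θ)) + (S ℝ (n - 1)).eval (2 * Real.cos (2 * θ))) *
      Real.sin θ = Real.sin ((2 * n + 1) * θ) := by
  have h1 := S_two_mul_real_cos (2 * θ) n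
  have h2 := S_two_mul_real_cos (2 * θ) (n - 1)
  have hc : Real.cos θ ≠ 0 := by
    intro h; apply hθ; rw [Real.sin_two_mul, h, mul_zero]
  have h3 : Real.sin ((n + 1) * (2 * θ)) + Real.sin (n * (2 * θ)) =
      2 * Real.sin ((2 * n + 1) * θ) * Real.cos θ := by
    have e1 : ((n : ℝ) + 1) * (2 * θ) = (2 * n + 1) * θ + θ := by ring
    have e2 : (n : ℝ) * (2 * θ) = (2 * n + 1) * θ - θ := by ring
    rw [e1, e2, Real.sin_add, Real.sin_sub]; ring
  push_cast at h2
  rw [sub_add_cancel] at h2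
  rw [← h1, ← h2, Real.sin_two_mul] at h3
  apply mul_right_cancel₀ hc
  linarith

theorem sin_two_mul_pi_div_ne_zero {m : ℕ} (hm : 3 ≤ m) : Real.sin (2 * (Real.pi / m)) ≠ 0 := by
  have hm' : (3 : ℝ) ≤ m := by exact_mod_cast hm
  have hpi := Real.pi_pos
  apply ne_of_gt
  apply Real.sin_pos_of_pos_of_lt_pi (by positivity)
  rw [← mul_div_assoc, div_lt_iff₀ (by linarith)]
  nlinarith

theorem geomReflection_isLiftable (M : CoxeterMatrix B) :
    M.IsLiftable (geomReflection M) := by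
  intro i j
  rcases eq_or_ne i j with rfl | hij
  · rw [M.diagonal, pow_one]
    ext1 v
    exact Module.involutive_reflection (coroot_single_self M i) v
  obtain hm0 | hm2 | hm3 : M i j = 0 ∨ M i j = 2 ∨ 3 ≤ M i j := by
    have := M.off_diagonal i j hij
    omega
  · rw [hm0, pow_zero]
  · have h1 : coroot M i (Finsupp.single j 1) = 0 := by simp [coroot_single, hm2]
    have h2 : coroot M j (Finsupp.single i 1) = 0 := by
      simp [coroot_single, M.symmetric j i, hm2]
    rw [hm2, pow_two]
    ext1 v
    simp only [geomReflection, LinearEquiv.mul_apply, Module.reflection_apply, map_sub, map_smul,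
      h1, h2, coroot_single_self, LinearEquiv.coe_one, id]
    module
  · ext1 v
    have hs := sin_two_mul_pi_div_ne_zero hm3
    have ht := coroot_mul_coroot_sub_two M i j
    have hm : ((M i j : ℕ) : ℝ) ≠ 0 := by
      have : M i j ≠ 0 := by omega
      exact_mod_cast this
    have hs' : Real.sin (Real.pi / M i j) ≠ 0 := by
      intro h; apply hs; rw [Real.sin_two_mul, h]; ring
    rw [geomReflection, geomReflection,
      Module.reflection_mul_reflection_pow_apply _ _ _ _ _ ht]
    rcases Nat.even_or_odd' (M i j) with ⟨n, hn | hn⟩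
    · have hz : (S ℝ ((n : ℤ) - 1)).eval (2 * Real.cos (2 * (Real.pi / M i j))) = 0 := by
        have h := S_two_mul_real_cos (2 * (Real.pi / M i j)) ((n : ℤ) - 1)
        have e : (((n : ℤ) - 1 : ℤ) + 1 : ℝ) * (2 * (Real.pi / M i j)) = Real.pi := by
          have : ((M i j : ℕ) : ℝ) = 2 * n := by rw [hn]; push_cast; ring
          rw [this] at hm ⊢
          push_cast
          have : (n : ℝ) ≠ 0 := by rintro h; simp [h] at hm
          field_simp
          ring
        rw [e, Real.sin_pi] at h
        exact (mul_eq_zero.mp h).resolve_right hs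
      have e1 : ((M i j : ℤ) - 1) / 2 = (n : ℤ) - 1 := by omega
      have e2 : ((M i j : ℤ) - 2) / 2 = (n : ℤ) - 1 := by omega
      rw [e1, e2, hz]
      simp
    · have hz := chebyshev_S_add_S_eval_two_mul_cos hs n
      have e : (2 * (n : ℤ) + 1 : ℝ) * (Real.pi / M i j) = Real.pi := by
        have : ((M i j : ℕ) : ℝ) = 2 * n + 1 := by rw [hn]; push_cast; ring
        rw [this] at hm ⊢
        push_cast
        field_simp
      rw [e, Real.sin_pi] at hz
      have hz := (mul_eq_zero.mp hz).resolve_right hs'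
      have e1 : ((M i j : ℤ) - 1) / 2 = n := by omega
      have e2 : ((M i j : ℤ) - 2) / 2 = (n : ℤ) - 1 := by omega
      have e3 : ((M i j : ℤ) - 3) / 2 = (n : ℤ) - 1 := by omega
      have e4 : (M i j : ℤ) / 2 = n := by omega
      rw [e1, e2, e3, e4, hz]
      simp

theorem geomReflection_mul_pow_ne_one (M : CoxeterMatrix B) {i j : B} (hij : i ≠ j) {k : ℕ}
    (hk : 0 < k) (hkM : M i j = 0 ∨ k < M i j) :
    (geomReflection M i * geomReflection M j) ^ k ≠ 1 := by
  intro h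
  have h := congrArg (fun f : (B →₀ ℝ) ≃ₗ[ℝ] (B →₀ ℝ) => f (Finsupp.single i 1)) h
  have hji := hij.symm
  have ht := coroot_mul_coroot_sub_two M i j
  simp only [geomReflection] at h
  rw [Module.reflection_mul_reflection_pow_apply_self _ _ _ _ ht] at h
  have hi := DFunLike.congr_fun h i
  have hj := DFunLike.congr_fun h j
  simp [hij, hji] at hi hj
  obtain hm0 | hm2 | hm3 : M i j = 0 ∨ M i j = 2 ∨ 3 ≤ M i j := by
    have := M.off_diagonal i j hij
    omega
  · simp [coroot_single, M.symmetric j i, hm0] at hj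
    omega
  · have : k = 1 := by omega
    subst this
    simp [hm2] at hi
    rw [mul_div_cancel₀ _ two_ne_zero, Real.cos_pi] at hi
    norm_num at hi
  · have hs := sin_two_mul_pi_div_ne_zero hm3
    have hz := chebyshev_S_add_S_eval_two_mul_cos hs k
    have hy := S_two_mul_real_cos (2 * (Real.pi / M i j)) ((k : ℤ) - 1)
    simp only [Int.cast_natCast] at hz
    rw [hi, one_mul] at hz
    have hc : coroot M j (Finsupp.single i 1) ≠ 0 := by
      rw [coroot_single, M.symmetric j i]
      intro h
      apply hs
      rw [Real.sin_two_mul]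
      linear_combination (- Real.sin (Real.pi / M i j)) * h
    rw [hj.resolve_right hc, zero_mul] at hy
    have hkm : k < M i j := by omega
    have hm' : (3 : ℝ) ≤ M i j := by exact_mod_cast hm3
    have hkm' : (k : ℝ) < M i j := by exact_mod_cast hkm
    have hk' : (0 : ℝ) < k := by exact_mod_cast hk
    set θ := Real.pi / M i j with hθ
    have hθ0 : 0 < θ := div_pos Real.pi_pos (by linarith)
    have hMθ : M i j * θ = Real.pi := by rw [hθ]; field_simp
    have hkθ : k * θ < Real.pi := by rw [← hMθ]; gcongr
    push_cast at hy
    rw [sub_add_cancel] at hy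
    have e : (k : ℝ) * (2 * θ) = 2 * (k * θ) := by ring
    rw [e, Real.sin_two_mul] at hy
    have hskθ : 0 < Real.sin (k * θ) := Real.sin_pos_of_pos_of_lt_pi (by positivity) hkθ
    have hckθ : Real.cos (k * θ) = 0 := by
      rcases mul_eq_zero.mp hy.symm with h | h
      · linarith
      · exact h
    have e2 : (2 * (k : ℝ) + 1) * θ = 2 * (k * θ) + θ := by ring
    rw [e2, Real.sin_add, Real.sin_two_mul, Real.cos_two_mul, hckθ] at hz
    have : 0 < Real.sin θ := by
      apply Real.sin_pos_of_pos_of_lt_pi hθ0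
      rw [← hMθ]; nlinarith
    linarith

end GeometricRepresentation

section Exchange

open CoxeterSystem List

variable {W : Type*} [Group W] {M : CoxeterMatrix B} (cs : CoxeterSystem M W)

local prefix:100 "s" => cs.simple
local prefix:100 "π" => cs.wordProd
local prefix:100 "ℓ" => cs.length

theorem coxeterMatrix_le_of_pow_eq_one {i j : B} (hij : i ≠ j) {k : ℕ} (hk : 0 < k)
    (h : (s i * s j) ^ k = 1) : M i j ≠ 0 ∧ M i j ≤ k := by
  by_contra hcon
  apply geomReflection_mul_pow_ne_one M hij hk (by omega)
  have := congrArg (cs.lift ⟨geomReflection M, geomReflection_isLiftable M⟩) h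
  simpa using this

open Classical in
/-- The action of a simple reflection on signed group elements: it conjugates the element, and
flips the sign exactly if the element is the given simple reflection. -/
noncomputable def signedConj (i : B) : Function.End (W × ZMod 2) := fun p =>
  (s i * p.1 * s i, p.2 + if p.1 = s i then 1 else 0)

open Classical in
theorem signedConj_prod_apply (ω : List B) (t : W) (ε : ZMod 2) :
    (ω.map (signedConj cs)).prod (t, ε) =
      (π ω * t * (π ω)⁻¹, ε + (cs.rightInvSeq ω).count t) := by
  induction ω with
  | nil => simp; rfl
  | cons i ω ih =>
    rw [List.map_cons, List.prod_cons]
    change signedConj cs i ((ω.map (signedConj cs)).prod (t, ε)) = _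
    rw [ih, signedConj, rightInvSeq, List.count_cons]
    ext1
    · simp [wordProd_cons, mul_assoc]
    · have : (π ω * t * (π ω)⁻¹ = s i) ↔ (((π ω)⁻¹ * s i * π ω == t) = true) := by
        rw [beq_iff_eq]
        constructor
        · intro h; rw [← h]; group
        · intro h; rw [← h]; group
      simp only [this]
      push_cast
      rw [add_assoc]

theorem signedConj_isLiftable : M.IsLiftable (signedConj cs) := by
  classical
  intro i j
  have hw : ∀ n : ℕ, ((alternatingWord i j (2 * n)).map (signedConj cs)).prod =
      (signedConj cs i * signedConj cs j) ^ n := by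
    intro n
    induction n with
    | zero => simp [alternatingWord]
    | succ n ih =>
      rw [show 2 * (n + 1) = (2 * n + 1) + 1 by ring, alternatingWord_succ, alternatingWord_succ,
        pow_succ, ← ih]
      simp
  rw [← hw]
  refine funext fun ⟨t, ε⟩ => ?_
  rw [signedConj_prod_apply]
  have h1 : π (alternatingWord i j (2 * M i j)) = 1 := by
    simp [prod_alternatingWord_eq_mul_pow]
  have hrev : ∀ (i j : B) (n : ℕ),
      (alternatingWord i j (2 * n)).reverse = alternatingWord j i (2 * n) := by
    intro i j n
    induction n with
    | zero => simp [alternatingWord]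
    | succ n ih =>
      rw [show 2 * (n + 1) = (2 * n + 1) + 1 by ring, alternatingWord_succ, alternatingWord_succ,
        alternatingWord_succ', alternatingWord_succ']
      simp [ih]
  have h2 : ((cs.rightInvSeq (alternatingWord i j (2 * M i j))).count t : ZMod 2) = 0 := by
    rw [← hrev j i, rightInvSeq_reverse, List.count_reverse]
    set L := cs.leftInvSeq (alternatingWord j i (2 * M i j)) with hL
    have hlen : L.length = 2 * M i j := by simp [hL]
    have : L.drop (M i j) = L.take (M i j) := by
      apply List.ext_getElem
      · simp [hlen]; omega
      · intro n h1 h2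
        simp only [List.length_drop, List.length_take, hlen] at h1 h2
        rw [List.getElem_drop, List.getElem_take]
        simp only [hL]
        rw [getElem_leftInvSeq_alternatingWord _ _ _ _ _ (by omega),
          getElem_leftInvSeq_alternatingWord _ _ _ _ _ (by omega),
          prod_alternatingWord_eq_mul_pow, prod_alternatingWord_eq_mul_pow,
          show (2 * (M i j + n) + 1) / 2 = M i j + n by omega,
          show (2 * n + 1) / 2 = n by omega, pow_add, simple_mul_simple_pow]
        simp
    rw [← List.take_append_drop (M i j) L, List.count_append, this]
    push_cast
    exact CharTwo.add_self_eq_zero _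
  rw [h1, h2]
  simp
  rfl

open Classical in
theorem count_rightInvSeq_eq {ω ω' : List B} (h : π ω = π ω') (t : W) :
    ((cs.rightInvSeq ω).count t : ZMod 2) = (cs.rightInvSeq ω').count t := by
  have key : ∀ ω : List B, (ω.map (signedConj cs)).prod =
      cs.lift ⟨signedConj cs, signedConj_isLiftable cs⟩ (π ω) := by
    intro ω
    rw [wordProd, map_list_prod, List.map_map]
    congr 1
    apply List.map_congr_left
    intro i _
    simp
  have h1 := signedConj_prod_apply cs ω t 0
  rw [key, h, ← key, signedConj_prod_apply] at h1
  simpa using (congrArg Prod.snd h1).symm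

/-- The exchange condition for right descents. -/
theorem exists_eraseIdx_of_isRightDescent (ω : List B) {i : B}
    (hi : cs.IsRightDescent (π ω) i) :
    ∃ j < ω.length, π ω * s i = π (ω.eraseIdx j) := by
  classical
  obtain ⟨ω', hω', hw⟩ := cs.exists_isReduced (π ω * s i)
  have hprod : π (ω' ++ [i]) = π ω := by
    rw [wordProd_append, ← hw]; simp
  have hred : cs.IsReduced (ω' ++ [i]) := by
    rw [CoxeterSystem.IsReduced, hprod, List.length_append, ← hω'.eq, ← hw]
    exact ((cs.isRightDescent_iff).mp hi).symm
  have hmem : s i ∈ cs.rightInvSeq (ω' ++ [i]) := by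
    rw [← List.concat_eq_append, rightInvSeq_concat]; simp
  have hcount := List.count_eq_one_of_mem hred.nodup_rightInvSeq hmem
  have h := count_rightInvSeq_eq cs hprod (s i)
  rw [hcount] at h
  have hmem' : s i ∈ cs.rightInvSeq ω := by
    by_contra hn
    rw [List.count_eq_zero_of_not_mem hn] at h
    simp at h
  obtain ⟨j, hj, he⟩ := List.getElem_of_mem hmem'
  refine ⟨j, by simpa using hj, ?_⟩
  rw [← wordProd_mul_getD_rightInvSeq, List.getD_eq_getElem _ _ hj, he]

end Exchange

section Braid

open CoxeterSystem List Relation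

/-- A word is obtained from another one by a single braid move. -/
def BraidStep (M : CoxeterMatrix B) (ω ω' : List B) : Prop :=
  ∃ (α β : List B) (i j : B), i ≠ j ∧ M i j ≠ 0 ∧
    ω = α ++ alternatingWord i j (M i j) ++ β ∧ ω' = α ++ alternatingWord j i (M i j) ++ β

/-- A word is obtained from another one by a braid move or by deleting a subword `[i, i]`. -/
def WordStep (M : CoxeterMatrix B) (ω ω' : List B) : Prop :=
  BraidStep M ω ω' ∨ ∃ (α β : List B) (i : B), ω = α ++ [i, i] ++ β ∧ ω' = α ++ β

theorem BraidStep.append_right {M : CoxeterMatrix B} {ω ω' : List B} (h : BraidStep M ω ω')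
    (γ : List B) : BraidStep M (ω ++ γ) (ω' ++ γ) := by
  obtain ⟨α, β, i, j, hij, hM, rfl, rfl⟩ := h
  exact ⟨α, β ++ γ, i, j, hij, hM, by simp, by simp⟩

theorem WordStep.append_right {M : CoxeterMatrix B} {ω ω' : List B} (h : WordStep M ω ω')
    (γ : List B) : WordStep M (ω ++ γ) (ω' ++ γ) := by
  rcases h with h | ⟨α, β, i, rfl, rfl⟩
  · exact Or.inl (h.append_right γ)
  · exact Or.inr ⟨α, β ++ γ, i, by simp, by simp⟩

theorem exists_alternatingWord_add (i j : B) (k n : ℕ) :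
    ∃ γ : List B, γ.length = k ∧ alternatingWord i j (k + n) = γ ++ alternatingWord i j n := by
  induction k with
  | zero => exact ⟨[], rfl, by simp⟩
  | succ k ih =>
    obtain ⟨γ, hγ, h⟩ := ih
    rw [show k + 1 + n = k + n + 1 by ring, alternatingWord_succ', h]
    exact ⟨_ :: γ, by simp [hγ], rfl⟩

variable {W : Type*} [Group W] {M : CoxeterMatrix B} (cs : CoxeterSystem M W)

local prefix:100 "s" => cs.simple
local prefix:100 "π" => cs.wordProd
local prefix:100 "ℓ" => cs.length

theorem BraidStep.wordProd_eq {ω ω' : List B} (h : BraidStep M ω ω') : π ω = π ω' := by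
  obtain ⟨α, β, i, j, -, -, rfl, rfl⟩ := h
  have := cs.wordProd_braidWord_eq i j
  rw [braidWord, braidWord, M.symmetric j i] at this
  simp [wordProd_append, this]

theorem WordStep.wordProd_eq {ω ω' : List B} (h : WordStep M ω ω') : π ω = π ω' := by
  rcases h with h | ⟨α, β, i, rfl, rfl⟩
  · exact h.wordProd_eq cs
  · simp [wordProd_append, wordProd_cons]

theorem wordProd_eq_of_reflTransGen {ω ω' : List B} (h : ReflTransGen (WordStep M) ω ω') :
    π ω = π ω' := by
  induction h with
  | refl => rfl
  | tail _ h ih => exact ih.trans (h.wordProd_eq cs)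

theorem pow_eq_one_of_wordProd_alternatingWord_eq {i j : B} {n : ℕ}
    (h : π (alternatingWord i j n) = π (alternatingWord j i n)) : (s i * s j) ^ n = 1 := by
  have hinv : ((s j * s i) ^ (n / 2))⁻¹ = (s i * s j) ^ (n / 2) := by
    rw [← inv_pow]; simp
  rw [prod_alternatingWord_eq_mul_pow, prod_alternatingWord_eq_mul_pow] at h
  split_ifs at h with hn
  · obtain ⟨k, rfl⟩ := hn
    rw [one_mul, one_mul] at h
    rw [show (k + k) / 2 = k by omega] at h hinv
    rw [pow_add]
    nth_rw 1 [h]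
    rw [← hinv, mul_inv_cancel]
  · obtain ⟨k, rfl⟩ := Nat.not_even_iff_odd.mp hn
    rw [show (2 * k + 1) / 2 = k by omega] at h hinv
    rw [show 2 * k + 1 = 1 + k + k by ring, pow_add, pow_add, pow_one, mul_assoc (s i), h,
      ← hinv]
    simp

theorem exists_isReduced_append_alternatingWord {w : W} {i j : B} (hij : i ≠ j)
    (hi : cs.IsRightDescent w i) (hj : cs.IsRightDescent w j) (n : ℕ)
    (hn : M i j = 0 ∨ n ≤ M i j) :
    ∃ γ : List B, cs.IsReduced (γ ++ alternatingWord i j n) ∧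
      π (γ ++ alternatingWord i j n) = w := by
  induction n generalizing i j with
  | zero =>
    obtain ⟨ω, hω, h⟩ := cs.exists_isReduced w
    exact ⟨ω, by simpa [alternatingWord] using hω, by simpa [alternatingWord] using h.symm⟩
  | succ n ih =>
    obtain ⟨γ, hγ, hw⟩ := ih hij.symm hj hi (by rw [M.symmetric j i]; omega)
    have hj' : cs.IsRightDescent (π (γ ++ alternatingWord j i n)) j := by rwa [hw]
    obtain ⟨k, hk, he⟩ := exists_eraseIdx_of_isRightDescent cs _ hj'
    rcases lt_or_ge k γ.length with hlt | hge
    · rw [List.eraseIdx_append_of_lt_length hlt] at he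
      have hprod : π (γ.eraseIdx k ++ alternatingWord i j (n + 1)) = w := by
        rw [alternatingWord_succ, List.concat_eq_append, ← List.append_assoc, wordProd_append,
          ← he, wordProd_singleton, simple_mul_simple_cancel_right, hw]
      refine ⟨γ.eraseIdx k, ?_, hprod⟩
      rw [CoxeterSystem.IsReduced, hprod, ← hw, hγ.eq]
      simp [List.length_eraseIdx_of_lt hlt]
      omega
    · exfalso
      obtain ⟨k, rfl⟩ := Nat.exists_eq_add_of_le hge
      simp only [List.length_append, length_alternatingWord] at hk
      obtain ⟨r, rfl⟩ : ∃ r, n = k + (r + 1) := ⟨n - k - 1, by omega⟩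
      obtain ⟨δ, hδ, hsplit⟩ := exists_alternatingWord_add j i k (r + 1)
      rw [hsplit, ← List.append_assoc, ← hδ, ← List.length_append,
        List.eraseIdx_append_of_length_le le_rfl, Nat.sub_self, alternatingWord_succ',
        List.eraseIdx_cons_zero, ← alternatingWord_succ'] at he
      simp only [wordProd_append, mul_assoc, mul_right_inj] at he
      have hpal : π (alternatingWord i j (r + 1)) = π (alternatingWord j i (r + 1)) := by
        rw [alternatingWord_succ, wordProd_concat, ← he, simple_mul_simple_cancel_right]
      have := coxeterMatrix_le_of_pow_eq_one cs hij r.succ_pos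
        (pow_eq_one_of_wordProd_alternatingWord_eq cs hpal)
      omega

theorem coxeterMatrix_ne_zero_of_isRightDescent {w : W} {i j : B} (hij : i ≠ j)
    (hi : cs.IsRightDescent w i) (hj : cs.IsRightDescent w j) : M i j ≠ 0 := by
  intro h
  obtain ⟨γ, hγ, hw⟩ :=
    exists_isReduced_append_alternatingWord cs hij hi hj (ℓ w + 1) (Or.inl h)
  have := hγ.eq
  rw [hw] at this
  simp at this
  omega

theorem isRightDescent_of_isReduced_append {ω : List B} {i : B} (h : cs.IsReduced (ω ++ [i])) :
    cs.IsRightDescent (π (ω ++ [i])) i := by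
  rw [IsRightDescent, h.eq, wordProd_append]
  simpa [Nat.lt_succ_iff] using cs.length_wordProd_le ω

theorem isReduced_of_append_left {ω ω' : List B} (h : cs.IsReduced (ω ++ ω')) :
    cs.IsReduced ω := by
  simpa using h.take ω.length

/-- Matsumoto's theorem: reduced words with the same product are related by braid moves. -/
theorem reflTransGen_braidStep_of_isReduced {ω ω' : List B} (hω : cs.IsReduced ω)
    (hω' : cs.IsReduced ω') (h : π ω = π ω') : ReflTransGen (BraidStep M) ω ω' := by
  obtain ⟨n, hn⟩ : ∃ n, ω.length = n := ⟨_, rfl⟩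
  induction n generalizing ω ω' with
  | zero =>
    have : ω'.length = 0 := by rw [← hω'.eq, ← h, hω.eq, hn]
    rw [List.length_eq_zero_iff] at hn this
    rw [hn, this]
  | succ n ih =>
    have hn' : ω'.length = n + 1 := by rw [← hω'.eq, ← h, hω.eq, hn]
    obtain rfl | ⟨υ, i, rfl⟩ := List.eq_nil_or_concat' ω
    · simp at hn
    obtain rfl | ⟨υ', j, rfl⟩ := List.eq_nil_or_concat' ω'
    · simp at hn'
    have key : ∀ {υ υ' : List B} {i : B}, cs.IsReduced (υ ++ [i]) → cs.IsReduced (υ' ++ [i]) →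
        π (υ ++ [i]) = π (υ' ++ [i]) → (υ ++ [i]).length = n + 1 →
        ReflTransGen (BraidStep M) (υ ++ [i]) (υ' ++ [i]) := by
      intro υ υ' i h₁ h₂ h hn
      rw [wordProd_append, wordProd_append, mul_left_inj] at h
      exact (ih (isReduced_of_append_left cs h₁) (isReduced_of_append_left cs h₂) h
        (by simpa using hn)).lift (· ++ [i]) fun _ _ h => h.append_right [i]
    rcases eq_or_ne i j with rfl | hij
    · exact key hω hω' h hn
    · have hi := isRightDescent_of_isReduced_append cs hω
      have hj := isRightDescent_of_isReduced_append cs hω'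
      rw [← h] at hj
      have hM := coxeterMatrix_ne_zero_of_isRightDescent cs hij hi hj
      obtain ⟨γ, hγ, hw⟩ :=
        exists_isReduced_append_alternatingWord cs hij hi hj (M i j) (Or.inr le_rfl)
      have hstep : BraidStep M (γ ++ alternatingWord j i (M i j))
          (γ ++ alternatingWord i j (M i j)) :=
        ⟨γ, [], j, i, hij.symm, by rwa [M.symmetric j i], by simp [M.symmetric j i],
          by simp [M.symmetric j i]⟩
      have hw' := hstep.wordProd_eq cs
      have hγ' : cs.IsReduced (γ ++ alternatingWord j i (M i j)) := by
        rw [CoxeterSystem.IsReduced, hw', hγ.eq]; simp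
      obtain ⟨m, hm⟩ := Nat.exists_eq_succ_of_ne_zero hM
      have e : ∀ i j : B, γ ++ alternatingWord i j (m + 1) =
          (γ ++ alternatingWord j i m) ++ [j] := by
        intro i j; rw [alternatingWord_succ]; simp
      rw [hm, Nat.succ_eq_add_one] at hγ hw hstep hw' hγ'
      rw [e i j] at hγ hw hstep hw'
      rw [e j i] at hstep hw' hγ'
      exact ((key hω hγ' (by rw [hw', hw]) hn).tail hstep).trans
        (key hγ hω' (by rw [hw, h])
          (by rw [← hγ.eq, hw, hω.eq, hn]))

/-- Tits' theorem: every word can be transformed into a reduced word by braid moves and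
deletions. -/
theorem exists_isReduced_reflTransGen_wordStep (ω : List B) :
    ∃ ω', cs.IsReduced ω' ∧ ReflTransGen (WordStep M) ω ω' := by
  induction ω using List.reverseRecOn with
  | nil => exact ⟨[], by simp [CoxeterSystem.IsReduced], .refl⟩
  | append_singleton ω i ih =>
    obtain ⟨υ, hυ, h⟩ := ih
    have h' : ReflTransGen (WordStep M) (ω ++ [i]) (υ ++ [i]) :=
      h.lift (· ++ [i]) fun _ _ h => h.append_right [i]
    by_cases hred : cs.IsReduced (υ ++ [i])
    · exact ⟨_, hred, h'⟩
    · obtain ⟨γ, hγ, hw⟩ := cs.exists_isReduced (π υ * s i)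
      have hprod : π (γ ++ [i]) = π υ := by rw [wordProd_append, ← hw]; simp
      have hlen : ℓ (π υ * s i) + 1 = ℓ (π υ) := by
        rcases cs.length_mul_simple (π υ) i with h | h
        · exact absurd (by
            rw [CoxeterSystem.IsReduced, wordProd_append, wordProd_singleton, h, hυ.eq]
            simp) hred
        · exact h
      have hγi : cs.IsReduced (γ ++ [i]) := by
        rw [CoxeterSystem.IsReduced, hprod, ← hlen, hw, hγ.eq]; simp
      have hb : ReflTransGen (WordStep M) (υ ++ [i]) (γ ++ [i] ++ [i]) :=
        (reflTransGen_braidStep_of_isReduced cs hυ hγi hprod.symm).lift (· ++ [i])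
          fun _ _ h => Or.inl (h.append_right [i])
      exact ⟨γ, hγ, (h'.trans hb).tail (Or.inr ⟨γ, [], i, by simp, by simp⟩)⟩

end Braid

section RunCount

open CoxeterSystem Relation

/-- Update the type of the current run and the number of runs on reading a letter of type `c`. -/
def countRun (c : Bool) (p : Option Bool × ℕ) : Option Bool × ℕ :=
  if p.1 = some c then p else (some c, p.2 + 1)

/-- Update the type of the current run and the number of runs on reading a letter whose type is
given by `τ`; letters of type `none` are ignored. -/
def runStep (τ : B → Option Bool) (p : Option Bool × ℕ) (i : B) : Option Bool × ℕ :=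
  (τ i).elim p fun c => countRun c p

/-- The number of maximal runs of letters of equal type in a word, where the type of a letter is
given by `τ` and letters of type `none` are ignored. -/
def runCount (τ : B → Option Bool) (ω : List B) : ℕ :=
  (ω.foldl (runStep τ) (none, 0)).2

variable {τ : B → Option Bool}

/-- A preorder on counting states that is preserved by `runStep`. -/
def RunLE (p q : Option Bool × ℕ) : Prop := p = q ∨ p.2 < q.2

theorem RunLE.snd_le {p q : Option Bool × ℕ} (h : RunLE p q) : p.2 ≤ q.2 := by
  rcases h with rfl | h
  exacts [le_rfl, h.le]

theorem RunLE.trans {p q r : Option Bool × ℕ} (h : RunLE p q) (h' : RunLE q r) : RunLE p r := by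
  rcases h with rfl | h
  · exact h'
  · exact Or.inr (h.trans_le h'.snd_le)

theorem runLE_countRun (c : Bool) (p : Option Bool × ℕ) : RunLE p (countRun c p) := by
  unfold countRun
  split_ifs
  · exact Or.inl rfl
  · exact Or.inr (Nat.lt_succ_self _)

theorem RunLE.countRun {p q : Option Bool × ℕ} (h : RunLE p q) (c : Bool) :
    RunLE (countRun c p) (countRun c q) := by
  rcases h with rfl | h
  · exact Or.inl rfl
  · obtain ⟨l, n⟩ := p
    obtain ⟨l', n'⟩ := q
    simp only at h
    simp only [RunLE, CoxFA.countRun]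
    split_ifs with h₁ h₂ h₂
    · exact Or.inr h
    · exact Or.inr (by simp only; omega)
    · subst h₂
      rcases Nat.lt_or_ge (n + 1) n' with h | h
      · exact Or.inr h
      · exact Or.inl (by ext1 <;> simp only; omega)
    · exact Or.inr (by simp only; omega)

theorem runLE_runStep (p : Option Bool × ℕ) (i : B) : RunLE p (runStep τ p i) := by
  unfold runStep
  cases τ i
  exacts [Or.inl rfl, runLE_countRun _ _]

theorem RunLE.runStep {p q : Option Bool × ℕ} (h : RunLE p q) (i : B) :
    RunLE (runStep τ p i) (runStep τ q i) := by
  unfold CoxFA.runStep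
  cases τ i
  exacts [h, h.countRun _]

theorem runLE_foldl (p : Option Bool × ℕ) (ω : List B) : RunLE p (ω.foldl (runStep τ) p) := by
  induction ω generalizing p with
  | nil => exact Or.inl rfl
  | cons i ω ih => exact (runLE_runStep p i).trans (ih _)

theorem RunLE.foldl {p q : Option Bool × ℕ} (h : RunLE p q) (ω : List B) :
    RunLE (ω.foldl (CoxFA.runStep τ) p) (ω.foldl (CoxFA.runStep τ) q) := by
  induction ω generalizing p q with
  | nil => exact h
  | cons i ω ih => exact ih (h.runStep i)

theorem runCount_append_le (α β γ : List B) :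
    runCount τ (α ++ γ) ≤ runCount τ (α ++ β ++ γ) := by
  simp only [runCount, List.foldl_append]
  exact ((runLE_foldl _ β).foldl γ).snd_le

theorem countRun_countRun (c : Bool) (p : Option Bool × ℕ) :
    countRun c (countRun c p) = countRun c p := by
  unfold countRun
  split_ifs <;> simp_all

open Classical in
theorem foldl_runStep_eq {c : Bool} {ω : List B} (hω : ∀ i ∈ ω, τ i = none ∨ τ i = some c)
    (p : Option Bool × ℕ) :
    ω.foldl (runStep τ) p = if ∃ i ∈ ω, τ i = some c then countRun c p else p := by
  induction ω generalizing p with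
  | nil => simp
  | cons i ω ih =>
    rw [List.foldl_cons, ih fun j hj => hω j (List.mem_cons_of_mem i hj)]
    rcases hω i List.mem_cons_self with h | h
    · simp [runStep, h]
    · simp [runStep, h, countRun_countRun]

theorem foldl_runStep_snd_le {c : Bool} {ω : List B}
    (hω : ∀ i ∈ ω, τ i = none ∨ τ i = some c) (p : Option Bool × ℕ) :
    (ω.foldl (runStep τ) p).2 ≤ p.2 + 1 := by
  rw [foldl_runStep_eq hω]
  unfold countRun
  split_ifs <;> simp

theorem runCount_append_le_succ {c : Bool} {ω : List B}
    (hω : ∀ i ∈ ω, τ i = none ∨ τ i = some c) (ω' : List B) :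
    runCount τ (ω' ++ ω) ≤ runCount τ ω' + 1 := by
  rw [runCount, List.foldl_append]
  exact foldl_runStep_snd_le hω _

theorem mem_alternatingWord {i j k : B} {n : ℕ} (hk : k ∈ alternatingWord i j n) :
    k = i ∨ k = j := by
  induction n generalizing i j with
  | zero => simp [alternatingWord] at hk
  | succ n ih =>
    rw [alternatingWord_succ, List.concat_eq_append, List.mem_append, List.mem_singleton] at hk
    rcases hk with hk | rfl
    exacts [(ih hk).symm, Or.inr rfl]

theorem mem_alternatingWord_iff {i j k : B} {n : ℕ} (hn : 2 ≤ n) :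
    k ∈ alternatingWord i j n ↔ k = i ∨ k = j := by
  obtain ⟨n, rfl⟩ := Nat.exists_eq_add_of_le' hn
  refine ⟨mem_alternatingWord, ?_⟩
  rw [alternatingWord_succ, alternatingWord_succ]
  rintro (rfl | rfl) <;> simp

theorem foldl_runStep_alternatingWord {i j : B} {c : Bool} (hi : τ i = none ∨ τ i = some c)
    (hj : τ j = none ∨ τ j = some c) {n : ℕ} (hn : 2 ≤ n) (p : Option Bool × ℕ) :
    (alternatingWord i j n).foldl (runStep τ) p = (alternatingWord j i n).foldl (runStep τ) p := by
  have h : ∀ i j : B, (τ i = none ∨ τ i = some c) → (τ j = none ∨ τ j = some c) →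
      ∀ k ∈ alternatingWord i j n, τ k = none ∨ τ k = some c := by
    intro i j hi hj k hk
    rcases mem_alternatingWord hk with rfl | rfl
    exacts [hi, hj]
  rw [foldl_runStep_eq (h i j hi hj), foldl_runStep_eq (h j i hj hi)]
  have hmem : (∃ k ∈ alternatingWord i j n, τ k = some c) ↔
      ∃ k ∈ alternatingWord j i n, τ k = some c := by
    simp only [mem_alternatingWord_iff hn, or_comm (a := _ = i)]
  simp only [hmem]

theorem le_foldl_runStep_alternatingWord {i j : B} {c d : Bool} (hi : τ i = some c)
    (hj : τ j = some d) (hcd : c ≠ d) (n : ℕ) {p : Option Bool × ℕ} (hp : p.1 = none ∨ 1 ≤ p.2) :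
    ((alternatingWord i j (n + 1)).foldl (runStep τ) p).1 = some d ∧
      n + 1 ≤ ((alternatingWord i j (n + 1)).foldl (runStep τ) p).2 := by
  induction n generalizing i j c d with
  | zero =>
    rw [alternatingWord_succ]
    simp only [alternatingWord, List.concat_eq_append, List.nil_append, List.foldl_cons,
      List.foldl_nil, runStep, hj, Option.elim_some, countRun]
    split_ifs with h
    · exact ⟨h, by simpa [h] using hp⟩
    · simp
  | succ n ih =>
    obtain ⟨h₁, h₂⟩ := ih hj hi hcd.symm
    rw [alternatingWord_succ, List.concat_eq_append, List.foldl_append]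
    simp [runStep, hj, countRun, h₁, hcd, h₂]

theorem foldl_runStep_fst_eq_none_or (ω : List B) {p : Option Bool × ℕ}
    (hp : p.1 = none ∨ 1 ≤ p.2) :
    (ω.foldl (runStep τ) p).1 = none ∨ 1 ≤ (ω.foldl (runStep τ) p).2 := by
  induction ω generalizing p with
  | nil => exact hp
  | cons i ω ih =>
    apply ih
    unfold runStep
    cases h : τ i with
    | none => exact hp
    | some c =>
      simp only [Option.elim_some, countRun]
      split_ifs
      · exact hp
      · exact Or.inr (by simp)

theorem le_runCount_append_alternatingWord {i j : B} {c d : Bool} (hi : τ i = some c)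
    (hj : τ j = some d) (hcd : c ≠ d) {n : ℕ} (hn : n ≠ 0) (α β : List B) :
    n ≤ runCount τ (α ++ alternatingWord i j n ++ β) := by
  obtain ⟨n, rfl⟩ := Nat.exists_eq_succ_of_ne_zero hn
  rw [runCount, List.foldl_append, List.foldl_append]
  exact (le_foldl_runStep_alternatingWord hi hj hcd n
    (foldl_runStep_fst_eq_none_or α (Or.inl rfl))).2.trans (runLE_foldl _ β).snd_le

end RunCount

section SpecialSubgroup

open CoxeterSystem Relation

variable {W : Type*} [Group W] {M : CoxeterMatrix B} (cs : CoxeterSystem M W)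

theorem simple_mem_sp {I : Set B} {i : B} (hi : i ∈ I) : cs.simple i ∈ sp cs I :=
  Subgroup.subset_closure ⟨i, hi, rfl⟩

theorem wordProd_mem_sp {I : Set B} {ω : List B} (hω : ∀ i ∈ ω, i ∈ I) :
    cs.wordProd ω ∈ sp cs I := by
  refine Subgroup.list_prod_mem _ fun w hw => ?_
  obtain ⟨i, hi, rfl⟩ := List.mem_map.1 hw
  exact simple_mem_sp cs (hω i hi)

theorem exists_wordProd_of_mem_sp {I : Set B} {w : W} (hw : w ∈ sp cs I) :
    ∃ ω : List B, (∀ i ∈ ω, i ∈ I) ∧ cs.wordProd ω = w := by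
  induction hw using Subgroup.closure_induction with
  | mem w hw =>
    obtain ⟨i, hi, rfl⟩ := hw
    exact ⟨[i], by simpa using hi, by simp⟩
  | one => exact ⟨[], by simp, by simp⟩
  | mul w w' _ _ h h' =>
    obtain ⟨ω, hω, rfl⟩ := h
    obtain ⟨ω', hω', rfl⟩ := h'
    refine ⟨ω ++ ω', fun i hi => ?_, cs.wordProd_append ω ω'⟩
    exact (List.mem_append.1 hi).elim (hω i) (hω' i)
  | inv w _ h =>
    obtain ⟨ω, hω, rfl⟩ := h
    exact ⟨ω.reverse, fun i hi => hω i (List.mem_reverse.1 hi), by simp⟩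

theorem BraidStep.subset {ω ω' : List B} (h : BraidStep M ω ω') : ω' ⊆ ω := by
  obtain ⟨α, β, i, j, hij, hM, rfl, rfl⟩ := h
  have h₂ : 2 ≤ M i j := by
    have := M.off_diagonal i j hij
    omega
  intro k
  simp only [List.mem_append, mem_alternatingWord_iff h₂]
  tauto

theorem WordStep.subset {ω ω' : List B} (h : WordStep M ω ω') : ω' ⊆ ω := by
  rcases h with h | ⟨α, β, i, rfl, rfl⟩
  · exact h.subset
  · intro k
    simp only [List.mem_append]
    tauto

theorem subset_of_reflTransGen {ω ω' : List B} (h : ReflTransGen (WordStep M) ω ω') :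
    ω' ⊆ ω := by
  induction h with
  | refl => exact List.Subset.refl _
  | tail _ h ih => exact fun k hk => ih (h.subset hk)

theorem reflTransGen_wordStep_of_isReduced {ω ω' : List B} (hω : cs.IsReduced ω)
    (hω' : cs.IsReduced ω') (h : cs.wordProd ω = cs.wordProd ω') :
    ReflTransGen (WordStep M) ω ω' :=
  ReflTransGen.mono (fun _ _ => Or.inl) _ _ (reflTransGen_braidStep_of_isReduced cs hω hω' h)

theorem mem_of_simple_mem_sp {I : Set B} {i : B} (h : cs.simple i ∈ sp cs I) : i ∈ I := by
  obtain ⟨ω, hω, hi⟩ := exists_wordProd_of_mem_sp cs h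
  obtain ⟨ω', hω', hωω'⟩ := exists_isReduced_reflTransGen_wordStep cs ω
  have hred : cs.IsReduced [i] := by simp [CoxeterSystem.IsReduced]
  have hchain := reflTransGen_wordStep_of_isReduced cs hω' hred
    (by rw [← wordProd_eq_of_reflTransGen cs hωω', hi, wordProd_singleton])
  exact hω i (subset_of_reflTransGen hωω' (subset_of_reflTransGen hchain (by simp)))

variable {G : Type*} [Group G]

theorem prod_map_eq {I : Set B} {f : sp cs I →* G} {gen : B → G}
    (hgen : ∀ i (hi : i ∈ I), gen i = f ⟨cs.simple i, simple_mem_sp cs hi⟩) {ω : List B}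
    (hω : ∀ i ∈ ω, i ∈ I) : (ω.map gen).prod = f ⟨cs.wordProd ω, wordProd_mem_sp cs hω⟩ := by
  induction ω with
  | nil => exact (map_one f).symm
  | cons i ω ih =>
    rw [List.map_cons, List.prod_cons, hgen i (hω i List.mem_cons_self),
      ih fun j hj => hω j (List.mem_cons_of_mem i hj), ← map_mul]
    congr 1

theorem prod_map_braid {I : Set B} {f : sp cs I →* G} {gen : B → G}
    (hgen : ∀ i (hi : i ∈ I), gen i = f ⟨cs.simple i, simple_mem_sp cs hi⟩) {i j : B}
    (hi : i ∈ I) (hj : j ∈ I) : ((alternatingWord j i (M i j)).map gen).prod =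
      ((alternatingWord i j (M i j)).map gen).prod := by
  have hmem : ∀ {i j : B}, i ∈ I → j ∈ I → ∀ n, ∀ k ∈ alternatingWord i j n, k ∈ I := by
    intro i j hi hj n k hk
    rcases mem_alternatingWord hk with rfl | rfl
    exacts [hi, hj]
  rw [prod_map_eq cs hgen (hmem hj hi _), prod_map_eq cs hgen (hmem hi hj _)]
  congr 2
  have := cs.wordProd_braidWord_eq i j
  rw [braidWord, braidWord, M.symmetric j i] at this
  exact this.symm

open Classical in
/-- The type of a letter relative to two sets of letters: `true` for letters only outside the
second set, `false` for letters only in the second set, and no type for common letters. -/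
noncomputable def letterType (SE SF : Set B) (i : B) : Option Bool :=
  if i ∈ SF then if i ∈ SE then none else some false else some true

theorem letterType_of_mem_left {SE SF : Set B} {i : B} (hi : i ∈ SE) :
    letterType SE SF i = none ∨ letterType SE SF i = some true := by
  unfold letterType
  split_ifs <;> simp

theorem letterType_of_mem_right {SE SF : Set B} {i : B} (hi : i ∈ SF) :
    letterType SE SF i = none ∨ letterType SE SF i = some false := by
  unfold letterType
  split_ifs <;> simp

variable {SE SF : Set B} {f₁ : sp cs SE →* G} {f₂ : sp cs SF →* G} {gen : B → G}

theorem exists_word_of_forall_mem_range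
    (h₁ : ∀ i (hi : i ∈ SE), gen i = f₁ ⟨cs.simple i, simple_mem_sp cs hi⟩)
    (h₂ : ∀ i (hi : i ∈ SF), gen i = f₂ ⟨cs.simple i, simple_mem_sp cs hi⟩) {l : List G}
    (hl : ∀ x ∈ l, x ∈ f₁.range ∨ x ∈ f₂.range) :
    ∃ ω : List B, (∀ i ∈ ω, i ∈ SE ∪ SF) ∧ (ω.map gen).prod = l.prod ∧
      runCount (letterType SE SF) ω ≤ l.length := by
  induction l using List.reverseRecOn with
  | nil => exact ⟨[], by simp, by simp, by simp [runCount]⟩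
  | append_singleton l x ih =>
    obtain ⟨ω, hω, hprod, hrun⟩ := ih fun y hy => hl y (List.mem_append_left _ hy)
    obtain ⟨υ, c, hυ, hυprod, hυtype⟩ : ∃ (υ : List B) (c : Bool), (∀ i ∈ υ, i ∈ SE ∪ SF) ∧
        (υ.map gen).prod = x ∧
        ∀ i ∈ υ, letterType SE SF i = none ∨ letterType SE SF i = some c := by
      rcases hl x (by simp) with ⟨⟨w, hw⟩, rfl⟩ | ⟨⟨w, hw⟩, rfl⟩ <;>
        obtain ⟨υ, hυ, rfl⟩ := exists_wordProd_of_mem_sp cs hw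
      · exact ⟨υ, true, fun i hi => Or.inl (hυ i hi), prod_map_eq cs h₁ hυ,
          fun i hi => letterType_of_mem_left (hυ i hi)⟩
      · exact ⟨υ, false, fun i hi => Or.inr (hυ i hi), prod_map_eq cs h₂ hυ,
          fun i hi => letterType_of_mem_right (hυ i hi)⟩
    refine ⟨ω ++ υ, fun i hi => (List.mem_append.1 hi).elim (hω i) (hυ i), ?_, ?_⟩
    · simp [hprod, hυprod]
    · rw [List.length_append, List.length_singleton]
      exact (runCount_append_le_succ hυtype ω).trans (by omega)

theorem WordStep.prod_map_eq_and_runCount_le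
    (h₁ : ∀ i (hi : i ∈ SE), gen i = f₁ ⟨cs.simple i, simple_mem_sp cs hi⟩)
    (h₂ : ∀ i (hi : i ∈ SF), gen i = f₂ ⟨cs.simple i, simple_mem_sp cs hi⟩) {m : ℕ}
    (hm : ∀ e ∈ SE \ SF, ∀ f ∈ SF \ SE, M e f ≠ 0 → m ≤ M e f) {ω ω' : List B}
    (h : WordStep M ω ω') (hω : ∀ i ∈ ω, i ∈ SE ∪ SF)
    (hrun : runCount (letterType SE SF) ω < m) :
    (ω'.map gen).prod = (ω.map gen).prod ∧
      runCount (letterType SE SF) ω' ≤ runCount (letterType SE SF) ω := by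
  rcases h with ⟨α, β, i, j, hij, hM, rfl, rfl⟩ | ⟨α, β, i, rfl, rfl⟩
  · have hM₂ : 2 ≤ M i j := by
      have := M.off_diagonal i j hij
      omega
    have hi : i ∈ SE ∪ SF := hω i (by simp [mem_alternatingWord_iff hM₂])
    have hj : j ∈ SE ∪ SF := hω j (by simp [mem_alternatingWord_iff hM₂])
    have hsame : ∀ {I : Set B} {f : sp cs I →* G} {c : Bool},
        (∀ i (hi : i ∈ I), gen i = f ⟨cs.simple i, simple_mem_sp cs hi⟩) →
        (∀ i ∈ I, letterType SE SF i = none ∨ letterType SE SF i = some c) →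
        i ∈ I → j ∈ I →
        ((α ++ alternatingWord j i (M i j) ++ β).map gen).prod =
            ((α ++ alternatingWord i j (M i j) ++ β).map gen).prod ∧
          runCount (letterType SE SF) (α ++ alternatingWord j i (M i j) ++ β) ≤
            runCount (letterType SE SF) (α ++ alternatingWord i j (M i j) ++ β) := by
      intro I f c hgen htype hi hj
      refine ⟨?_, le_of_eq ?_⟩
      · simp only [List.map_append, List.prod_append, prod_map_braid cs hgen hi hj]
      · simp only [runCount, List.foldl_append,
          foldl_runStep_alternatingWord (htype j hj) (htype i hi) hM₂]
    by_cases hE : i ∈ SE ∧ j ∈ SE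
    · exact hsame h₁ (fun _ => letterType_of_mem_left) hE.1 hE.2
    by_cases hF : i ∈ SF ∧ j ∈ SF
    · exact hsame h₂ (fun _ => letterType_of_mem_right) hF.1 hF.2
    exfalso
    have htrue : ∀ {k}, k ∈ SE \ SF → letterType SE SF k = some true := fun hk => by
      simp [letterType, hk.2]
    have hfalse : ∀ {k}, k ∈ SF \ SE → letterType SE SF k = some false := fun hk => by
      simp [letterType, hk.1, hk.2]
    have hmixed : (i ∈ SE \ SF ∧ j ∈ SF \ SE) ∨ (j ∈ SE \ SF ∧ i ∈ SF \ SE) := by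
      simp only [Set.mem_union, Set.mem_sdiff] at hi hj ⊢
      tauto
    rcases hmixed with ⟨hi, hj⟩ | ⟨hj, hi⟩
    · have := le_runCount_append_alternatingWord (htrue hi) (hfalse hj) (by simp) hM α β
      have := hm i hi j hj hM
      omega
    · have := le_runCount_append_alternatingWord (hfalse hi) (htrue hj) (by simp) hM α β
      have := hm j hj i hi (by rwa [M.symmetric])
      rw [M.symmetric] at this
      omega
  · refine ⟨?_, runCount_append_le _ _ _⟩
    have hi : gen i * gen i = 1 := by
      rcases hω i (by simp) with h | h
      · rw [h₁ i h, ← map_mul, ← map_one f₁]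
        congr 1
        ext
        simp
      · rw [h₂ i h, ← map_mul, ← map_one f₂]
        congr 1
        ext
        simp
    simp [← mul_assoc, hi]

theorem prod_map_eq_and_runCount_le_of_reflTransGen
    (h₁ : ∀ i (hi : i ∈ SE), gen i = f₁ ⟨cs.simple i, simple_mem_sp cs hi⟩)
    (h₂ : ∀ i (hi : i ∈ SF), gen i = f₂ ⟨cs.simple i, simple_mem_sp cs hi⟩) {m : ℕ}
    (hm : ∀ e ∈ SE \ SF, ∀ f ∈ SF \ SE, M e f ≠ 0 → m ≤ M e f) {ω ω' : List B}
    (h : ReflTransGen (WordStep M) ω ω') (hω : ∀ i ∈ ω, i ∈ SE ∪ SF)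
    (hrun : runCount (letterType SE SF) ω < m) :
    (ω'.map gen).prod = (ω.map gen).prod ∧
      runCount (letterType SE SF) ω' ≤ runCount (letterType SE SF) ω := by
  induction h with
  | refl => exact ⟨rfl, le_rfl⟩
  | tail h h' ih =>
    obtain ⟨ih₁, ih₂⟩ := ih
    obtain ⟨h₁, h₂⟩ := h'.prod_map_eq_and_runCount_le cs h₁ h₂ hm
      (fun i hi => hω i (subset_of_reflTransGen h hi)) (by omega)
    exact ⟨h₁.trans ih₁, h₂.trans ih₂⟩

theorem prod_eq_one_of_length_le
    (h₁ : ∀ i (hi : i ∈ SE), gen i = f₁ ⟨cs.simple i, simple_mem_sp cs hi⟩)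
    (h₂ : ∀ i (hi : i ∈ SF), gen i = f₂ ⟨cs.simple i, simple_mem_sp cs hi⟩)
    {ρ : G →* W} (hρ₁ : ∀ w, ρ (f₁ w) = w) (hρ₂ : ∀ w, ρ (f₂ w) = w) {m : ℕ} (hm₀ : m ≠ 0)
    (hm : ∀ e ∈ SE \ SF, ∀ f ∈ SF \ SE, M e f ≠ 0 → m ≤ M e f) {l : List G}
    (hl : ∀ x ∈ l, x ∈ f₁.range ∨ x ∈ f₂.range) (hlen : l.length ≤ 2 * (m - 1))
    (hprod : ρ l.prod = 1) : l.prod = 1 := by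
  have hρgen : ∀ {ω : List B}, (∀ i ∈ ω, i ∈ SE ∪ SF) →
      ρ (ω.map gen).prod = cs.wordProd ω := by
    intro ω hω
    rw [map_list_prod, List.map_map, wordProd]
    congr 1
    refine List.map_congr_left fun i hi => ?_
    rcases hω i hi with h | h
    · simp [h₁ i h, hρ₁]
    · simp [h₂ i h, hρ₂]
  have hred : ∀ l' : List G, (∀ x ∈ l', x ∈ f₁.range ∨ x ∈ f₂.range) → l'.length < m →
      ∃ ω, cs.IsReduced ω ∧ (∀ i ∈ ω, i ∈ SE ∪ SF) ∧ (ω.map gen).prod = l'.prod ∧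
        runCount (letterType SE SF) ω < m := by
    intro l' hl' hlen'
    obtain ⟨ω, hω, hωprod, hωrun⟩ := exists_word_of_forall_mem_range cs h₁ h₂ hl'
    obtain ⟨ω', hω', hωω'⟩ := exists_isReduced_reflTransGen_wordStep cs ω
    obtain ⟨hp, hr⟩ := prod_map_eq_and_runCount_le_of_reflTransGen cs h₁ h₂ hm hωω' hω (by omega)
    exact ⟨ω', hω', fun i hi => hω i (subset_of_reflTransGen hωω' hi), hp.trans hωprod, by omega⟩
  obtain ⟨ω₁, hω₁, hsub₁, hprod₁, hrun₁⟩ := hred (l.take (m - 1))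
    (fun x hx => hl x (List.mem_of_mem_take hx)) (by rw [List.length_take]; omega)
  obtain ⟨ω₂, hω₂, hsub₂, hprod₂, -⟩ := hred (l.drop (m - 1))
    (fun x hx => hl x (List.mem_of_mem_drop hx))
    (by rw [List.length_drop]; omega)
  have hsplit : l.prod = (ω₁.map gen).prod * (ω₂.map gen).prod := by
    rw [hprod₁, hprod₂, ← List.prod_append, List.take_append_drop]
  have hπ : cs.wordProd ω₁ = cs.wordProd ω₂.reverse := by
    rw [hsplit, map_mul, hρgen hsub₁, hρgen hsub₂] at hprod
    rw [wordProd_reverse]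
    exact eq_inv_of_mul_eq_one_left hprod
  have hinv : ∀ i ∈ SE ∪ SF, (gen i)⁻¹ = gen i := by
    rintro i (h | h)
    · rw [h₁ i h, ← map_inv]
      congr 1
      ext
      simp
    · rw [h₂ i h, ← map_inv]
      congr 1
      ext
      simp
  have hrev : (ω₂.reverse.map gen).prod = (ω₂.map gen).prod⁻¹ := by
    rw [List.prod_inv_reverse, List.map_reverse, List.map_map]
    congr 2
    exact List.map_congr_left fun i hi => (hinv i (hsub₂ i hi)).symm
  obtain ⟨hp, -⟩ := prod_map_eq_and_runCount_le_of_reflTransGen cs h₁ h₂ hm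
    (reflTransGen_wordStep_of_isReduced cs hω₁ ((cs.isReduced_reverse_iff ω₂).2 hω₂) hπ)
    hsub₁ hrun₁
  rw [hsplit, ← hp, hrev, inv_mul_cancel]

theorem AltList.mem_or_mem {P Q : Subgroup G} {l : List G} (h : AltList P Q l) {x : G}
    (hx : x ∈ l) : x ∈ P ∨ x ∈ Q := by
  induction l generalizing P Q with
  | nil => simp at hx
  | cons y l ih =>
    rcases List.mem_cons.1 hx with rfl | hx
    exacts [Or.inl h.1, (ih h.2 hx).symm]

theorem AltList.mem_of_append_singleton {P Q : Subgroup G} {l : List G} {x : G}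
    (h : AltList P Q (l ++ [x])) : (Even l.length → x ∈ P) ∧ (Odd l.length → x ∈ Q) := by
  induction l generalizing P Q with
  | nil => simpa [AltList] using h
  | cons y l ih =>
    obtain ⟨hP, hQ⟩ := ih h.2
    rw [List.length_cons, Nat.even_add_one, Nat.not_even_iff_odd, Nat.odd_add_one,
      Nat.not_odd_iff_even]
    exact ⟨hQ, hP⟩

theorem prod_eq_one_of_length_lt
    (h₁ : ∀ i (hi : i ∈ SE), gen i = f₁ ⟨cs.simple i, simple_mem_sp cs hi⟩)
    (h₂ : ∀ i (hi : i ∈ SF), gen i = f₂ ⟨cs.simple i, simple_mem_sp cs hi⟩)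
    {ρ : G →* W} (hρ₁ : ∀ w, ρ (f₁ w) = w) (hρ₂ : ∀ w, ρ (f₂ w) = w) {m : ℕ} (hm₂ : 2 ≤ m)
    (hm : ∀ e ∈ SE \ SF, ∀ f ∈ SF \ SE, M e f ≠ 0 → m ≤ M e f) {l : List G}
    (hl : AltList f₁.range f₂.range l ∨ AltList f₂.range f₁.range l) (hlen : l.length < 2 * m)
    (hprod : ρ l.prod = 1) : l.prod = 1 := by
  have hmem : ∀ x ∈ l, x ∈ f₁.range ∨ x ∈ f₂.range := fun x hx =>
    hl.elim (fun h => h.mem_or_mem hx) fun h => (h.mem_or_mem hx).symm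
  rcases Nat.lt_or_ge (2 * (m - 1)) l.length with hlt | hle
  swap
  · exact prod_eq_one_of_length_le cs h₁ h₂ hρ₁ hρ₂ (by omega) hm hmem hle hprod
  cases l with
  | nil => simp at hlt
  | cons x l =>
    obtain rfl | ⟨l, y, rfl⟩ := List.eq_nil_or_concat' l
    · simp only [List.length_singleton] at hlt
      omega
    have hodd : Odd l.length := by
      simp only [List.length_cons, List.length_append, List.length_nil] at hlt hlen
      exact ⟨m - 2, by omega⟩
    have hyx : y * x ∈ f₁.range ∨ y * x ∈ f₂.range :=
      hl.imp (fun h => mul_mem (h.2.mem_of_append_singleton.2 hodd) h.1)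
        fun h => mul_mem (h.2.mem_of_append_singleton.2 hodd) h.1
    have hconj : (l ++ [y * x]).prod = x⁻¹ * (x :: (l ++ [y])).prod * x := by
      simp [mul_assoc]
    have := prod_eq_one_of_length_le cs h₁ h₂ hρ₁ hρ₂ (by omega) hm (l := l ++ [y * x])
      (by
        simp only [List.mem_append, List.mem_singleton]
        rintro z (hz | rfl)
        exacts [hmem z (by simp [hz]), hyx])
      (by simp only [List.length_cons, List.length_append, List.length_nil] at hlen ⊢; omega)
      (by rw [hconj, map_mul, map_mul, hprod, mul_one, ← map_mul, inv_mul_cancel, map_one])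
    rw [hconj] at this
    rwa [mul_assoc, inv_mul_eq_one, eq_comm, mul_eq_right] at this

end SpecialSubgroup

section AmalgamatedProduct

open Monoid

variable {H : Type*} [Group H]

theorem intoA_eq_intoB (A B K : Subgroup H) (hA : K ≤ A) (hB : K ≤ B) {w : H} (hw : w ∈ K) :
    intoA A B K hA hB ⟨w, hA hw⟩ = intoB A B K hA hB ⟨w, hB hw⟩ :=
  (PushoutI.of_apply_eq_base (phi2 A B K hA hB) true ⟨w, hw⟩).trans
    (PushoutI.of_apply_eq_base (phi2 A B K hA hB) false ⟨w, hw⟩).symm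

@[simp]
theorem rhoK_intoA (A B K : Subgroup H) (hA : K ≤ A) (hB : K ≤ B) (w : A) :
    rhoK A B K hA hB (intoA A B K hA hB w) = w :=
  PushoutI.lift_of (φ := phi2 A B K hA hB) _ _ _ (i := true) w

@[simp]
theorem rhoK_intoB (A B K : Subgroup H) (hA : K ≤ A) (hB : K ≤ B) (w : B) :
    rhoK A B K hA hB (intoB A B K hA hB w) = w :=
  PushoutI.lift_of (φ := phi2 A B K hA hB) _ _ _ (i := false) w

theorem exists_altList_mul {P Q : Subgroup H} {g x : H} (hx : x ∈ P ∨ x ∈ Q)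
    (hg : ∃ l : List H, l.prod = g ∧ AltList P Q l) :
    ∃ l : List H, l.prod = x * g ∧ AltList P Q l := by
  obtain ⟨l, rfl, hl⟩ := hg
  rcases hx with hx | hx
  · exact ⟨x :: 1 :: l, by simp, hx, one_mem _, hl⟩
  · exact ⟨1 :: x :: l, by simp, one_mem _, hx, hl⟩

theorem nfSet_nonempty (A B K : Subgroup H) (hA : K ≤ A) (hB : K ≤ B) (g : AmalgK A B K hA hB) :
    (nfSet (intoA A B K hA hB).range (intoB A B K hA hB).range g).Nonempty := by
  suffices h : ∀ x : AmalgK A B K hA hB, (∃ l : List (AmalgK A B K hA hB), l.prod = x ∧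
      AltList (intoA A B K hA hB).range (intoB A B K hA hB).range l) →
      ∃ l : List (AmalgK A B K hA hB), l.prod = g * x ∧
        AltList (intoA A B K hA hB).range (intoB A B K hA hB).range l by
    obtain ⟨l, hl, hl'⟩ := h 1 ⟨[], rfl, trivial⟩
    exact ⟨l.length, l, rfl, by rw [hl, mul_one], Or.inl hl'⟩
  induction g using PushoutI.induction_on with
  | of i w =>
    intro x hx
    cases i
    · exact exists_altList_mul (Or.inr ⟨w, rfl⟩) hx
    · exact exists_altList_mul (Or.inl ⟨w, rfl⟩) hx
  | base w =>
    intro x hx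
    refine exists_altList_mul (Or.inl ⟨phi2 A B K hA hB true w, ?_⟩) hx
    exact PushoutI.of_apply_eq_base (phi2 A B K hA hB) true w
  | mul g g' h h' =>
    intro x hx
    rw [mul_assoc]
    exact h _ (h' x hx)

theorem altList_replicate {P Q : Subgroup H} {x y : H} (hx : x ∈ P) (hy : y ∈ Q) (n : ℕ) :
    AltList P Q (List.replicate n [x, y]).flatten := by
  induction n with
  | zero => trivial
  | succ n ih => exact ⟨hx, hy, ih⟩

theorem nfLength_mul_pow_le {P Q : Subgroup H} {x y : H} (hx : x ∈ P) (hy : y ∈ Q) (n : ℕ) :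
    nfLength P Q ((x * y) ^ n) ≤ 2 * n :=
  Nat.sInf_le ⟨_, by simp [mul_comm], by simp, Or.inl (altList_replicate hx hy n)⟩

theorem intoA_mul_intoB_pow_ne_one (A B K : Subgroup H) (hA : K ≤ A) (hB : K ≤ B) {x : A} {y : B}
    (hx : (x : H) ∉ K) (hy : (y : H) ∉ K) {n : ℕ} (hn : n ≠ 0) :
    (intoA A B K hA hB x * intoB A B K hA hB y) ^ n ≠ 1 := by
  intro h
  let p : Σ i, fam2 A B i := ⟨true, x⟩
  let q : Σ i, fam2 A B i := ⟨false, y⟩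
  have hmem : ∀ z ∈ (List.replicate n [p, q]).flatten, z = p ∨ z = q := by
    intro z hz
    obtain ⟨l, hl, hz⟩ := List.mem_flatten.1 hz
    rw [List.eq_of_mem_replicate hl] at hz
    simpa using hz
  have hchain : ∀ n, (q :: (List.replicate n [p, q]).flatten).IsChain fun z z' => z.1 ≠ z'.1 := by
    intro n
    induction n with
    | zero => simp
    | succ n ih =>
      rw [List.replicate_succ, List.flatten_cons, List.cons_append, List.cons_append,
        List.nil_append, List.isChain_cons_cons, List.isChain_cons_cons]
      exact ⟨by simp [p, q], by simp [p, q], ih⟩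
  let w : CoprodI.Word fun i => fam2 A B i :=
    { toList := (List.replicate n [p, q]).flatten
      ne_one := by
        intro z hz hz₁
        rcases hmem z hz with rfl | rfl
        · exact hx (by rw [show x = 1 from hz₁]; exact one_mem K)
        · exact hy (by rw [show y = 1 from hz₁]; exact one_mem K)
      chain_ne := (hchain n).tail }
  have hw : PushoutI.Reduced (phi2 A B K hA hB) w := by
    rintro z hz ⟨k, hk⟩
    rcases hmem z hz with rfl | rfl
    · exact hx ((congrArg Subtype.val hk : (k : H) = x) ▸ k.2)
    · exact hy ((congrArg Subtype.val hk : (k : H) = y) ▸ k.2)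
  have hinj : ∀ i, Function.Injective (phi2 A B K hA hB i) := by
    rintro (_ | _)
    exacts [Subgroup.inclusion_injective hB, Subgroup.inclusion_injective hA]
  have hprod : PushoutI.ofCoprodI (φ := phi2 A B K hA hB) w.prod =
      (intoA A B K hA hB x * intoB A B K hA hB y) ^ n := by
    rw [CoprodI.Word.prod, map_list_prod, List.map_map, List.map_flatten, List.map_replicate,
      List.prod_flatten, List.map_replicate, List.prod_replicate]
    simp [p, q, PushoutI.ofCoprodI_of, intoA, intoB]
  have := hw.eq_empty_of_mem_range hinj (by rw [hprod, h]; exact one_mem _)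
  have := congrArg (fun w => w.toList.length) this
  simp [w, CoprodI.Word.empty, hn] at this

end AmalgamatedProduct

section Angle

variable {W : Type*} [Group W] {M : CoxeterMatrix B} (cs : CoxeterSystem M W) {SE SF : Set B}

theorem exists_generators (SE SF : Set B) : ∃ gen : B →
      AmalgK (sp cs SE) (sp cs SF) (sp cs SE ⊓ sp cs SF) inf_le_left inf_le_right,
    (∀ i (hi : i ∈ SE), gen i = intoA _ _ _ _ _ ⟨cs.simple i, simple_mem_sp cs hi⟩) ∧
      ∀ i (hi : i ∈ SF), gen i = intoB _ _ _ _ _ ⟨cs.simple i, simple_mem_sp cs hi⟩ := by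
  classical
  refine ⟨fun i => if hi : i ∈ SE then intoA _ _ _ _ _ ⟨cs.simple i, simple_mem_sp cs hi⟩ else
    if hi : i ∈ SF then intoB _ _ _ _ _ ⟨cs.simple i, simple_mem_sp cs hi⟩ else 1, ?_, ?_⟩
  · intro i hi
    simp only [hi, dif_pos]
  · intro i hi
    by_cases hi' : i ∈ SE
    · simp only [hi', dif_pos]
      exact intoA_eq_intoB _ _ _ _ _
        (Subgroup.mem_inf.2 ⟨simple_mem_sp cs hi', simple_mem_sp cs hi⟩)
    · simp only [hi, hi', dif_pos, dif_neg, not_false_eq_true]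

theorem eq_one_of_nfLength_lt {m : ℕ} (hm₂ : 2 ≤ m)
    (hm : ∀ e ∈ SE \ SF, ∀ f ∈ SF \ SE, M e f ≠ 0 → m ≤ M e f)
    {g : AmalgK (sp cs SE) (sp cs SF) (sp cs SE ⊓ sp cs SF) inf_le_left inf_le_right}
    (hg : g ∈ (rhoK (sp cs SE) (sp cs SF) (sp cs SE ⊓ sp cs SF) inf_le_left inf_le_right).ker)
    (hlt : nfLength (intoA (sp cs SE) (sp cs SF) _ inf_le_left inf_le_right).range
      (intoB (sp cs SE) (sp cs SF) _ inf_le_left inf_le_right).range g < 2 * m) : g = 1 := by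
  obtain ⟨gen, h₁, h₂⟩ := exists_generators cs SE SF
  obtain ⟨l, hlen, rfl, hl⟩ := Nat.sInf_mem (nfSet_nonempty _ _ _ _ _ g)
  exact prod_eq_one_of_length_lt cs h₁ h₂ (rhoK_intoA _ _ _ _ _) (rhoK_intoB _ _ _ _ _) hm₂ hm hl
    (hlen.trans_lt hlt) hg

theorem gsAngle_eq_zero (h : ∀ e ∈ SE \ SF, ∀ f ∈ SF \ SE, M e f = 0) :
    gsAngle (sp cs SE) (sp cs SF) = 0 := by
  refine if_pos ((injective_iff_map_eq_one _).2 fun g hg => ?_)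
  exact eq_one_of_nfLength_lt cs (m := nfLength (intoA (sp cs SE) (sp cs SF) _ _ _).range
    (intoB (sp cs SE) (sp cs SF) _ _ _).range g + 2) (by omega)
    (fun e he f hf hne => absurd (h e he f hf) hne) hg (by omega)

theorem gsAngle_eq_pi_div {e f : B} (he : e ∈ SE \ SF) (hf : f ∈ SF \ SE) (hef : M e f ≠ 0)
    (hmin : ∀ e' ∈ SE \ SF, ∀ f' ∈ SF \ SE, M e' f' ≠ 0 → M e f ≤ M e' f') :
    gsAngle (sp cs SE) (sp cs SF) = Real.pi / M e f := by
  have hne : e ≠ f := fun h => hf.2 (h ▸ he.1)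
  have hm₂ : 2 ≤ M e f := by
    have := M.off_diagonal e f hne
    omega
  set ρ := rhoK (sp cs SE) (sp cs SF) (sp cs SE ⊓ sp cs SF) inf_le_left inf_le_right with hρ
  obtain ⟨g, hg, hg₁, hle⟩ : ∃ g ∈ ρ.ker, g ≠ 1 ∧
      nfLength (intoA (sp cs SE) (sp cs SF) _ inf_le_left inf_le_right).range
        (intoB (sp cs SE) (sp cs SF) _ inf_le_left inf_le_right).range g ≤ 2 * M e f := by
    refine ⟨(intoA _ _ _ _ _ ⟨cs.simple e, simple_mem_sp cs he.1⟩ *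
      intoB _ _ _ _ _ ⟨cs.simple f, simple_mem_sp cs hf.1⟩) ^ M e f, ?_, ?_, ?_⟩
    · simp [MonoidHom.mem_ker, hρ]
    · exact intoA_mul_intoB_pow_ne_one _ _ _ _ _
        (fun h => he.2 (mem_of_simple_mem_sp cs (Subgroup.mem_inf.1 h).2))
        (fun h => hf.2 (mem_of_simple_mem_sp cs (Subgroup.mem_inf.1 h).1)) hef
    · exact nfLength_mul_pow_le (MonoidHom.mem_range.2 ⟨_, rfl⟩) (MonoidHom.mem_range.2 ⟨_, rfl⟩) _
  have hge : ∀ g' ∈ ρ.ker, g' ≠ 1 →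
      2 * M e f ≤ nfLength (intoA (sp cs SE) (sp cs SF) _ inf_le_left inf_le_right).range
        (intoB (sp cs SE) (sp cs SF) _ inf_le_left inf_le_right).range g' := fun g' hg' hne' =>
    not_lt.1 fun hlt => hne' (eq_one_of_nfLength_lt cs hm₂ hmin hg' hlt)
  have hinj : ¬ Function.Injective ρ := fun h =>
    hg₁ (h ((MonoidHom.mem_ker.1 hg).trans (map_one ρ).symm))
  have hinf : sInf {k | ∃ g, g ∈ ρ.ker ∧ g ≠ 1 ∧
      nfLength (intoA (sp cs SE) (sp cs SF) _ inf_le_left inf_le_right).range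
        (intoB (sp cs SE) (sp cs SF) _ inf_le_left inf_le_right).range g = k} = 2 * M e f := by
    refine le_antisymm ?_ ?_
    · refine le_trans (Nat.sInf_le ?_) hle
      exact ⟨g, hg, hg₁, rfl⟩
    · obtain ⟨g', hg', hne', h⟩ := Nat.sInf_mem (s := {k | ∃ g, g ∈ ρ.ker ∧ g ≠ 1 ∧
        nfLength (intoA (sp cs SE) (sp cs SF) _ inf_le_left inf_le_right).range
          (intoB (sp cs SE) (sp cs SF) _ inf_le_left inf_le_right).range g = k})
        ⟨_, g, hg, hg₁, rfl⟩
      exact h ▸ hge g' hg' hne'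
  rw [gsAngle, if_neg hinj, hinf]
  push_cast
  rw [mul_div_mul_left _ _ two_ne_zero]

theorem gsAngle_congr {SE' SF' : Set B} (hE : SE \ SF = SE' \ SF') (hF : SF \ SE = SF' \ SE') :
    gsAngle (sp cs SE) (sp cs SF) = gsAngle (sp cs SE') (sp cs SF') := by
  by_cases h : ∀ e ∈ SE \ SF, ∀ f ∈ SF \ SE, M e f = 0
  · rw [gsAngle_eq_zero cs h, gsAngle_eq_zero cs (by rwa [← hE, ← hF])]
  · have hne : {k | ∃ e ∈ SE \ SF, ∃ f ∈ SF \ SE, M e f ≠ 0 ∧ M e f = k}.Nonempty := by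
      push Not at h
      obtain ⟨e, he, f, hf, hef⟩ := h
      exact ⟨_, e, he, f, hf, hef, rfl⟩
    obtain ⟨e, he, f, hf, hef, hk⟩ := Nat.sInf_mem hne
    have hmin : ∀ e' ∈ SE \ SF, ∀ f' ∈ SF \ SE, M e' f' ≠ 0 → M e f ≤ M e' f' :=
      fun e' he' f' hf' hne' => hk ▸ Nat.sInf_le ⟨e', he', f', hf', hne', rfl⟩
    rw [gsAngle_eq_pi_div cs he hf hef hmin]
    rw [hE, hF] at hmin
    exact (gsAngle_eq_pi_div cs (hE ▸ he) (hF ▸ hf) hef hmin).symm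

theorem disjoint_of_sp_inf_eq_bot {I J : Set B} (h : sp cs I ⊓ sp cs J = ⊥) : Disjoint I J := by
  refine Set.disjoint_left.2 fun i hI hJ => ?_
  have hi : cs.simple i ∈ sp cs I ⊓ sp cs J := ⟨simple_mem_sp cs hI, simple_mem_sp cs hJ⟩
  rw [h, Subgroup.mem_bot] at hi
  have := cs.length_simple i
  simp [hi] at this

theorem union_diff_union_eq {I J K : Set B} (h : Disjoint I K) : (I ∪ K) \ (J ∪ K) = I \ J := by
  ext i
  have := @Set.disjoint_left _ I K
  simp only [Set.mem_sdiff, Set.mem_union]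
  have := fun hI : i ∈ I => Set.disjoint_left.1 h hI
  tauto

end Angle

/-- If `A`, `B`, `C` are special subgroups of `W` with
`A ∩ C = {1} = B ∩ C`, then `∠(A, B; A ∩ B) = ∠(⟨A,C⟩, ⟨B,C⟩; ⟨A ∩ B, C⟩)`.
In particular, for `a ≠ b` in `S` and `T ⊆ S − {a, b}`,
`∠(⟨{a} ∪ T⟩, ⟨{b} ∪ T⟩; ⟨T⟩) = π / m_{a,b}` (where `π/∞ = 0`). -/
theorem stmt_9 {W : Type*} [Group W] [Fintype B] {M : CoxeterMatrix B}
    (cs : CoxeterSystem M W) (SA SB SC : Set B)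
    (hAC : sp cs SA ⊓ sp cs SC = ⊥) (hBC : sp cs SB ⊓ sp cs SC = ⊥) :
    gsAngle (sp cs SA) (sp cs SB) = gsAngle (sp cs (SA ∪ SC)) (sp cs (SB ∪ SC)) ∧
    ∀ (a b : B), a ≠ b → ∀ T : Set B, a ∉ T → b ∉ T →
      gsAngle (sp cs ({a} ∪ T)) (sp cs ({b} ∪ T)) =
        if M a b = 0 then 0 else Real.pi / (M a b : ℝ) := by
  refine ⟨gsAngle_congr cs (union_diff_union_eq (disjoint_of_sp_inf_eq_bot cs hAC)).symm
    (union_diff_union_eq (disjoint_of_sp_inf_eq_bot cs hBC)).symm, fun a b hab T ha hb => ?_⟩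
  have hE : ({a} ∪ T) \ ({b} ∪ T) = {a} := by
    rw [union_diff_union_eq (Set.disjoint_singleton_left.2 ha)]
    simpa using hab
  have hF : ({b} ∪ T) \ ({a} ∪ T) = {b} := by
    rw [union_diff_union_eq (Set.disjoint_singleton_left.2 hb)]
    simpa using hab.symm
  split_ifs with h
  · exact gsAngle_eq_zero cs (by rw [hE, hF]; simpa using h)
  · exact gsAngle_eq_pi_div cs (by rw [hE]; rfl) (by rw [hF]; rfl) h (by rw [hE, hF]; simp)

end CoxFA
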